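/- Consider the ABP system G_a' with the forward channel under person-in-the-middle attack and with the dead transitions removed, with uncontrollable events Σ_uc = {send, done, timeout, deliver, p0, p1, a0, a1} and observable events Σ_o = {p0, p1, p0', p1', a0, a1, a0', a1'} with natural projection P. Let M = { s ∈ L(G_a') : s contains at least one occurrence of send and no occurrence of deliver after the first send } (violation of the liveness property that the first send is eventually followed by a deliver). Then the string send · p0 · p1' · a1 · timeout belongs to L(G_a'), and there exists a nonempty sublanguage K ⊆ M that is controllable with respect to (L(G_a'), Σ_uc) and normal with respect to (L(G_a'), P); hence a For-all attack on this liveness property exists. -/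

import Mathlib

/-! Model of the Alternating Bit Protocol (ABP) as a synchronous composition of
finite-state automata, following Alur et al. and the paper's Section 4. -/

/-- Events of the ABP system. -/
inductive Ev
  | send | done | timeout | deliver
  | p0 | p1 | p0' | p1'
  | a0 | a1 | a0' | a1'
  deriving DecidableEq

/-- Sender states. -/
inductive SSt | s0 | s1 | s2 | s3 | s4 | s5 | s6 | s7 deriving DecidableEq
/-- Receiver states. -/
inductive RSt | r0 | r1 | r2 | r3 | r4 | r5 deriving DecidableEq
/-- Forward channel states. -/
inductive FSt | f0 | f1 | f2 deriving DecidableEq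
/-- Backward channel states. -/
inductive BSt | b0 | b1 | b2 deriving DecidableEq
/-- Sending client states. -/
inductive CSt | c0 | c1 deriving DecidableEq

/-- Sender (ABP sender) transitions. -/
def sndTrans : List (SSt × Ev × SSt) :=
  [(.s0, .a0', .s0), (.s0, .a1', .s0), (.s0, .timeout, .s0), (.s0, .send, .s1),
   (.s1, .p0, .s2), (.s2, .send, .s1), (.s2, .timeout, .s1), (.s2, .a1', .s2), (.s2, .a0', .s3),
   (.s3, .done, .s4), (.s4, .a0', .s4), (.s4, .timeout, .s4), (.s4, .send, .s5), (.s4, .a1', .s5),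
   (.s5, .p1, .s6), (.s6, .send, .s5), (.s6, .timeout, .s5), (.s6, .a1', .s7), (.s7, .done, .s0)]

/-- Receiver (ABP receiver) transitions. -/
def rcvTrans : List (RSt × Ev × RSt) :=
  [(.r0, .p0', .r1), (.r0, .p1', .r5), (.r1, .deliver, .r2), (.r2, .a0, .r3),
   (.r3, .p0', .r2), (.r3, .p1', .r4), (.r4, .deliver, .r0), (.r5, .a1, .r0)]

/-- Nominal (nondeterministic) forward channel transitions. -/
def fcTrans : List (FSt × Ev × FSt) :=
  [(.f0, .p0, .f0), (.f0, .p1, .f0), (.f0, .p0, .f1), (.f0, .p1, .f2),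
   (.f1, .p0, .f1), (.f1, .p1, .f1), (.f1, .p0', .f1), (.f1, .p0', .f0),
   (.f2, .p0, .f2), (.f2, .p1, .f2), (.f2, .p1', .f2), (.f2, .p1', .f0)]

/-- Nominal (nondeterministic) backward channel transitions. -/
def bcTrans : List (BSt × Ev × BSt) :=
  [(.b0, .a0, .b0), (.b0, .a1, .b0), (.b0, .a0, .b1), (.b0, .a1, .b2),
   (.b1, .a0, .b1), (.b1, .a1, .b1), (.b1, .a0', .b1), (.b1, .a0', .b0),
   (.b2, .a0, .b2), (.b2, .a1, .b2), (.b2, .a1', .b2), (.b2, .a1', .b0)]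

/-- Sending client transitions. -/
def scTrans : List (CSt × Ev × CSt) :=
  [(.c0, .done, .c0), (.c0, .send, .c1), (.c1, .done, .c0)]

/-- Component alphabets. -/
def sndAlph (e : Ev) : Prop := e ∈ ([.send, .done, .timeout, .p0, .p1, .a0', .a1'] : List Ev)
def rcvAlph (e : Ev) : Prop := e ∈ ([.deliver, .p0', .p1', .a0, .a1] : List Ev)
def fcAlph (e : Ev) : Prop := e ∈ ([.p0, .p1, .p0', .p1'] : List Ev)
def bcAlph (e : Ev) : Prop := e ∈ ([.a0, .a1, .a0', .a1'] : List Ev)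
def scAlph (e : Ev) : Prop := e ∈ ([.send, .done] : List Ev)

/-- Synchronization of one component: if the event is in the component's alphabet, the
component must execute a transition on it; otherwise the component does not move.
(The one-state receiving client with self-loop `deliver` and the one-state timer with
self-loop `timeout` never constrain nor change anything, so they are left implicit.) -/
def sync {Q : Type*} (alph : Ev → Prop) (trans : List (Q × Ev × Q))
    (q : Q) (e : Ev) (q' : Q) : Prop :=
  (alph e ∧ (q, e, q') ∈ trans) ∨ (¬ alph e ∧ q' = q)

/-- Global states of the ABP system. -/
structure GSt where
  snd : SSt
  rcv : RSt
  fc : FSt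
  bc : BSt
  sc : CSt
  deriving DecidableEq

/-- Global step of the synchronous composition, parametrized by the sender, forward
channel and sending-client transition lists (these vary across the setups). -/
def gstep (sT : List (SSt × Ev × SSt)) (fT : List (FSt × Ev × FSt))
    (cT : List (CSt × Ev × CSt)) (q : GSt) (e : Ev) (q' : GSt) : Prop :=
  sync sndAlph sT q.snd e q'.snd ∧
  sync rcvAlph rcvTrans q.rcv e q'.rcv ∧
  sync fcAlph fT q.fc e q'.fc ∧
  sync bcAlph bcTrans q.bc e q'.bc ∧
  sync scAlph cT q.sc e q'.sc

/-- Runs of the composition: `Reach step q0 s q` iff the string `s` can be executed from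
`q0`, ending in global state `q`. -/
inductive Reach (step : GSt → Ev → GSt → Prop) (q0 : GSt) : List Ev → GSt → Prop
  | nil : Reach step q0 [] q0
  | snoc {s : List Ev} {q : GSt} {e : Ev} {q' : GSt} :
      Reach step q0 s q → step q e q' → Reach step q0 (s ++ [e]) q'

/-- Initial global state. -/
def init : GSt := ⟨.s0, .r0, .f0, .b0, .c0⟩

/-- Generated language of the composition. -/
def Lang (step : GSt → Ev → GSt → Prop) : Set (List Ev) :=
  {s | ∃ q, Reach step init s q}

/-! Abstract supervisory-control notions on languages. -/

/-- Prefix closure `pr(K)`. -/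
def prefixClosure {A : Type*} (K : Set (List A)) : Set (List A) := {s | ∃ t ∈ K, s <+: t}

/-- Controllability of `K` w.r.t. `(L, Auc)`. -/
def IsControllable {A : Type*} (K L : Set (List A)) (Auc : Set A) : Prop :=
  ∀ s ∈ prefixClosure K, ∀ σ ∈ Auc, s ++ [σ] ∈ L → s ++ [σ] ∈ prefixClosure K

/-- Normality of `K` w.r.t. `(L, P)`: `pr(K) = P⁻¹(P(pr(K))) ∩ L`. -/
def IsNormalLang {A : Type*} (K L : Set (List A)) (P : List A → List A) : Prop :=
  prefixClosure K = {s | ∃ t ∈ prefixClosure K, P s = P t} ∩ L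

/-- Sender transitions with the dead transitions removed. -/
def sndTrans' : List (SSt × Ev × SSt) :=
  [(.s0, .a1', .s0), (.s0, .timeout, .s0), (.s0, .send, .s1),
   (.s1, .p0, .s2), (.s2, .timeout, .s1), (.s2, .a1', .s2), (.s2, .a0', .s3),
   (.s3, .done, .s4), (.s4, .a0', .s4), (.s4, .timeout, .s4), (.s4, .send, .s5),
   (.s5, .p1, .s6), (.s6, .timeout, .s5), (.s6, .a1', .s7), (.s7, .done, .s0)]

/-- Sending client with the dead transition `c0 −done→ c0` removed. -/
def scTrans' : List (CSt × Ev × CSt) :=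
  [(.c0, .send, .c1), (.c1, .done, .c0)]

/-- Forward channel under the person-in-the-middle attack. -/
def fcTransAtk : List (FSt × Ev × FSt) :=
  fcTrans ++
  [(.f1, .p1', .f1), (.f1, .p1', .f0), (.f2, .p0', .f2), (.f2, .p0', .f0)]

/-- The attacked ABP system `G_a'` without dead transitions (forward channel attacked). -/
def atkStep' : GSt → Ev → GSt → Prop := gstep sndTrans' fcTransAtk scTrans'

/-- Uncontrollable events for the attacker. -/
def Euc : Set Ev :=
  {e | e ∈ ([.send, .done, .timeout, .deliver, .p0, .p1, .a0, .a1] : List Ev)}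

/-- Natural projection onto the attacker's observable events
`Eo = {p0, p1, p0', p1', a0, a1, a0', a1'}`. -/
def P (s : List Ev) : List Ev :=
  s.filter (fun e => decide (e ∈ ([.p0, .p1, .p0', .p1', .a0, .a1, .a0', .a1'] : List Ev)))

/-- Violation of the liveness property: strings of `L(G_a')` containing at least one
`send` and no occurrence of `deliver` after the first `send`. -/
def M : Set (List Ev) :=
  {s | s ∈ Lang atkStep' ∧
    ∃ u v : List Ev, s = u ++ Ev.send :: v ∧ Ev.send ∉ u ∧ Ev.deliver ∉ v}

theorem Reach.mem_lang_of_prefix {step : GSt → Ev → GSt → Prop} {s t : List Ev} {q : GSt}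
    (h : Reach step init s q) (hts : t <+: s) : t ∈ Lang step := by
  induction h with
  | nil =>
    rw [List.prefix_nil] at hts
    exact ⟨init, hts ▸ Reach.nil⟩
  | snoc hr hstep ih =>
    rcases List.prefix_concat_iff.mp hts with rfl | h
    · exact ⟨_, Reach.snoc hr hstep⟩
    · exact ih h

/-- As long as the receiver never gets `p0'`, it alternates between `r0` and `r5`. -/
theorem atkStep'_rcv {q q' : GSt} {e : Ev} (h : atkStep' q e q') (he : e ≠ .p0')
    (hq : q.rcv = .r0 ∨ q.rcv = .r5) : (q'.rcv = .r0 ∨ q'.rcv = .r5) ∧ e ≠ .deliver := by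
  obtain ⟨-, h, -⟩ := h
  rcases hq with hq | hq <;> rw [hq] at h <;>
    cases e <;> simp_all [sync, rcvAlph, rcvTrans]

/-- The sender and its client leave their initial states only by a `send`. -/
theorem atkStep'_snd {q q' : GSt} {e : Ev} (h : atkStep' q e q') (he : e ≠ .send)
    (hs : q.snd = .s0) (hc : q.sc = .c0) : q'.snd = .s0 ∧ q'.sc = .c0 := by
  obtain ⟨h1, -, -, -, h2⟩ := h
  rw [hs] at h1
  rw [hc] at h2
  cases e <;> simp_all [sync, sndAlph, scAlph, sndTrans', scTrans']

theorem reach_rcv {s : List Ev} {q : GSt} (h : Reach atkStep' init s q) (hs : Ev.p0' ∉ s) :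
    (q.rcv = .r0 ∨ q.rcv = .r5) ∧ Ev.deliver ∉ s := by
  induction h with
  | nil => simp [init]
  | snoc _ hstep ih =>
    simp only [List.mem_append, List.mem_singleton, not_or] at hs ⊢
    obtain ⟨hq, hd⟩ := ih hs.1
    obtain ⟨hq', he⟩ := atkStep'_rcv hstep (Ne.symm hs.2) hq
    exact ⟨hq', hd, he.symm⟩

theorem reach_snd {s : List Ev} {q : GSt} (h : Reach atkStep' init s q) (hs : Ev.send ∉ s) :
    q.snd = .s0 ∧ q.sc = .c0 := by
  induction h with
  | nil => simp [init]
  | snoc _ hstep ih =>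
    simp only [List.mem_append, List.mem_singleton, not_or] at hs
    obtain ⟨h1, h2⟩ := ih hs.1
    exact atkStep'_snd hstep (Ne.symm hs.2) h1 h2

theorem append_send_mem_lang {s : List Ev} (h : s ∈ Lang atkStep') (hs : Ev.send ∉ s) :
    s ++ [Ev.send] ∈ Lang atkStep' := by
  obtain ⟨q, hq⟩ := h
  obtain ⟨h1, h2⟩ := reach_snd hq hs
  refine ⟨⟨.s1, q.rcv, q.fc, q.bc, .c1⟩, hq.snoc ?_⟩
  simp [atkStep', gstep, sync, sndAlph, rcvAlph, fcAlph, bcAlph, scAlph, sndTrans', scTrans',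
    h1, h2]

/-- The attack language: the attacker never lets `p0'` through. -/
def attackLang : Set (List Ev) :=
  {s | s ∈ Lang atkStep' ∧ Ev.p0' ∉ s ∧ Ev.send ∈ s}

theorem mem_prefixClosure_attackLang {s : List Ev} :
    s ∈ prefixClosure attackLang ↔ s ∈ Lang atkStep' ∧ Ev.p0' ∉ s := by
  constructor
  · rintro ⟨t, ⟨⟨q, hq⟩, hp, -⟩, hst⟩
    exact ⟨hq.mem_lang_of_prefix hst, fun h => hp (hst.subset h)⟩
  · rintro ⟨hL, hp⟩
    by_cases hs : Ev.send ∈ s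
    · exact ⟨s, ⟨hL, hp, hs⟩, List.prefix_refl s⟩
    · exact ⟨s ++ [Ev.send], ⟨append_send_mem_lang hL hs, by simp [hp], by simp⟩,
        List.prefix_append _ _⟩

theorem attackLang_subset_M : attackLang ⊆ M := by
  rintro s ⟨hL, hp, hs⟩
  refine ⟨hL, ?_⟩
  obtain ⟨q, hq⟩ := hL
  obtain ⟨u, v, rfl, hu⟩ := List.eq_append_cons_of_mem hs
  refine ⟨u, v, rfl, hu, fun hv => (reach_rcv hq hp).2 ?_⟩
  simp [hv]

theorem isControllable_attackLang : IsControllable attackLang (Lang atkStep') Euc := by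
  intro s hs σ hσ hL
  rw [mem_prefixClosure_attackLang] at hs ⊢
  refine ⟨hL, ?_⟩
  have : Ev.p0' ≠ σ := by
    rintro rfl
    simp [Euc] at hσ
  simp [hs.2, this]

theorem p0'_mem_P {s : List Ev} : Ev.p0' ∈ P s ↔ Ev.p0' ∈ s := by
  simp [P]

theorem isNormalLang_attackLang : IsNormalLang attackLang (Lang atkStep') P := by
  ext s
  constructor
  · intro hs
    exact ⟨⟨s, hs, rfl⟩, (mem_prefixClosure_attackLang.mp hs).1⟩
  · rintro ⟨⟨t, ht, hP⟩, hL⟩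
    rw [mem_prefixClosure_attackLang] at ht ⊢
    refine ⟨hL, ?_⟩
    rw [← p0'_mem_P, hP, p0'_mem_P]
    exact ht.2

theorem send_p0_p1'_a1_timeout_mem_lang :
    ([.send, .p0, .p1', .a1, .timeout] : List Ev) ∈ Lang atkStep' := by
  refine ⟨⟨.s1, .r0, .f0, .b0, .c1⟩, ?_⟩
  have h1 : Reach atkStep' init [.send] ⟨.s1, .r0, .f0, .b0, .c1⟩ :=
    Reach.nil.snoc (by simp [init, atkStep', gstep, sync, sndAlph, rcvAlph, fcAlph, bcAlph, scAlph,
      sndTrans', rcvTrans, fcTransAtk, fcTrans, bcTrans, scTrans'])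
  have h2 : Reach atkStep' init [.send, .p0] ⟨.s2, .r0, .f1, .b0, .c1⟩ :=
    h1.snoc (by simp [atkStep', gstep, sync, sndAlph, rcvAlph, fcAlph, bcAlph, scAlph,
      sndTrans', rcvTrans, fcTransAtk, fcTrans, bcTrans, scTrans'])
  have h3 : Reach atkStep' init [.send, .p0, .p1'] ⟨.s2, .r5, .f0, .b0, .c1⟩ :=
    h2.snoc (by simp [atkStep', gstep, sync, sndAlph, rcvAlph, fcAlph, bcAlph, scAlph,
      sndTrans', rcvTrans, fcTransAtk, fcTrans, bcTrans, scTrans'])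
  have h4 : Reach atkStep' init [.send, .p0, .p1', .a1] ⟨.s2, .r0, .f0, .b0, .c1⟩ :=
    h3.snoc (by simp [atkStep', gstep, sync, sndAlph, rcvAlph, fcAlph, bcAlph, scAlph,
      sndTrans', rcvTrans, fcTransAtk, fcTrans, bcTrans, scTrans'])
  exact h4.snoc (by simp [atkStep', gstep, sync, sndAlph, rcvAlph, fcAlph, bcAlph, scAlph,
      sndTrans', rcvTrans, fcTransAtk, fcTrans, bcTrans, scTrans'])

/-- the string `send · p0 · p1' · a1 · timeout` belongs to `L(G_a')`,
and there is a nonempty sublanguage `K ⊆ M` controllable w.r.t. `(L(G_a'), Euc)` and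
normal w.r.t. `(L(G_a'), P)`; hence a For-all attack on the liveness property (the first
`send` is eventually followed by a `deliver`) exists. -/
theorem stmt10 :
    ([.send, .p0, .p1', .a1, .timeout] : List Ev) ∈ Lang atkStep' ∧
    ∃ K : Set (List Ev), K.Nonempty ∧ K ⊆ M ∧
      IsControllable K (Lang atkStep') Euc ∧
      IsNormalLang K (Lang atkStep') P := by
  exact ⟨send_p0_p1'_a1_timeout_mem_lang, attackLang,
    ⟨_, send_p0_p1'_a1_timeout_mem_lang, by simp, by simp⟩,
    attackLang_subset_M, isControllable_attackLang, isNormalLang_attackLang⟩
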